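/- arXiv:2201.04689 — 2 statements merged into one kernel-verified Lean document; each statement's English description precedes it below -/
import Mathlib

section
/- Let X be a complex Banach space with open unit ball B, and let h : B → X be a holomorphic function with h(0) = 0 and Dh(0) = Id. Suppose that ‖h(x)‖ ≤ M for all x ∈ B. Then, with r = 1/√(4M² + 1) and P = 1/(2M + √(4M² + 1)), there exists an open subset U of the ball of radius r centered at 0 such that h maps U biholomorphically onto the open ball of radius P centered at 0 (i.e., h restricted to U is a bijection onto B_P(0) whose inverse is holomorphic). -/
open Metric Set Function Filter
open scoped Topology ComplexConjugate

section EarleHamilton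

variable {E : Type*} [NormedAddCommGroup E] [NormedSpace ℂ E] {f : E → E} {r s : ℝ}

/-- If a holomorphic map `f` sends a ball into a strictly smaller concentric ball, then the larger
ball has a holomorphic self-map `F` which agrees with `f^[n]` at a given point and whose derivative
there is the derivative of `f^[n]` multiplied by a geometrically growing factor. -/
theorem exists_mapsTo_ball_fderiv_eq_pow_smul_fderiv_iterate
    (hf : DifferentiableOn ℂ f (ball 0 r)) (hmaps : MapsTo f (ball 0 r) (closedBall 0 s))
    (hsr : s < r) {x : E} (hx : x ∈ ball 0 r) (n : ℕ) :
    ∃ F : E → E, DifferentiableOn ℂ F (ball 0 r) ∧ MapsTo F (ball 0 r) (ball 0 r) ∧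
      F x = f^[n] x ∧ f^[n] x ∈ ball 0 r ∧
      ∃ L : E →L[ℂ] E, HasFDerivAt f^[n] L x ∧
        HasFDerivAt F (((1 + (r - s) / (2 * r) : ℝ) ^ n : ℂ) • L) x := by
  have hr : 0 < r := nonempty_ball.1 ⟨x, hx⟩
  have hs : 0 ≤ s := nonempty_closedBall.1 ⟨_, hmaps hx⟩
  induction n with
  | zero =>
    refine ⟨id, differentiableOn_id, mapsTo_id _, rfl, hx, .id ℂ E, hasFDerivAt_id x, ?_⟩
    simpa using hasFDerivAt_id x
  | succ n ih =>
    obtain ⟨F, hFd, hFm, hFx, hfx, L, hL, hFL⟩ := ih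
    set δ : ℝ := (r - s) / (2 * r) with hδ
    have hδ0 : 0 < δ := div_pos (by linarith) (by linarith)
    set p := f^[n] x with hp
    have hfp : HasFDerivAt f (fderiv ℂ f p) p :=
      (hf.differentiableAt (isOpen_ball.mem_nhds hfx)).hasFDerivAt
    have hgd : DifferentiableOn ℂ (fun z => f z + (δ : ℂ) • (f z - f p)) (ball 0 r) :=
      hf.add ((hf.sub_const _).const_smul _)
    refine ⟨(fun z => f z + (δ : ℂ) • (f z - f p)) ∘ F, hgd.comp hFd hFm, ?_, ?_, ?_,
      (fderiv ℂ f p).comp L, ?_, ?_⟩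
    · refine MapsTo.comp (fun z hz => ?_) hFm
      have h1 : ‖f z‖ ≤ s := by simpa using hmaps hz
      have h2 : ‖f p‖ ≤ s := by simpa using hmaps hfx
      rw [mem_ball_zero_iff]
      have h3 : ‖(δ : ℂ) • (f z - f p)‖ ≤ δ * (s + s) := by
        rw [norm_smul, Complex.norm_real, Real.norm_of_nonneg hδ0.le]
        gcongr
        exact (norm_sub_le _ _).trans (by gcongr)
      have h4 : δ * (s + s) < r - s := by
        rw [hδ, div_mul_eq_mul_div, div_lt_iff₀ (by positivity)]
        nlinarith
      linarith [norm_add_le (f z) ((δ : ℂ) • (f z - f p))]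
    · simp [hFx, hp, iterate_succ_apply']
    · rw [iterate_succ_apply']
      exact closedBall_subset_ball hsr (hmaps hfx)
    · rw [iterate_succ']
      exact hfp.comp x hL
    · have hg : HasFDerivAt (fun z => f z + (δ : ℂ) • (f z - f p))
          (fderiv ℂ f p + (δ : ℂ) • fderiv ℂ f p) (F x) := by
        rw [hFx]
        exact hfp.add ((hfp.sub_const _).const_smul _)
      refine (hg.comp x hFL).congr_fderiv ?_
      ext v
      simp only [ContinuousLinearMap.comp_apply, add_apply,
        smul_apply, map_smul, pow_succ]
      push_cast
      module

/-- The derivatives of the iterates of a holomorphic map sending a ball into a strictly smaller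
concentric ball decay geometrically. -/
theorem exists_hasFDerivAt_iterate_norm_le
    (hf : DifferentiableOn ℂ f (ball 0 r)) (hmaps : MapsTo f (ball 0 r) (closedBall 0 s))
    (hsr : s < r) {x : E} (hx : x ∈ closedBall 0 s) (n : ℕ) :
    ∃ L : E →L[ℂ] E, HasFDerivAt f^[n] L x ∧
      ‖L‖ ≤ 2 * r / (r - s) * ((1 + (r - s) / (2 * r))⁻¹) ^ n := by
  have hxr := closedBall_subset_ball hsr hx
  have hr : 0 < r := nonempty_ball.1 ⟨x, hxr⟩
  obtain ⟨F, hFd, hFm, -, -, L, hL, hFL⟩ :=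
    exists_mapsTo_ball_fderiv_eq_pow_smul_fderiv_iterate hf hmaps hsr hxr n
  refine ⟨L, hL, ?_⟩
  have hrs : 0 < r - s := by linarith
  have hδ : 0 < 1 + (r - s) / (2 * r) := by positivity
  have hsub : ball x (r - s) ⊆ ball 0 r := by
    refine ball_subset_ball' ?_
    have : dist x 0 ≤ s := hx
    linarith
  have := Complex.norm_fderiv_le_div_of_mapsTo_ball (R₂ := 2 * r) (hFd.mono hsub)
    (fun z hz => by
      have h1 := hFm (hsub hz)
      have h2 := hFm hxr
      rw [mem_ball_zero_iff] at h1 h2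
      rw [mem_closedBall, dist_eq_norm]
      linarith [norm_sub_le (F z) (F x)]) hrs
  rw [hFL.fderiv, norm_smul, norm_pow, Complex.norm_real, Real.norm_of_nonneg hδ.le] at this
  rw [inv_pow, ← div_eq_mul_inv, le_div_iff₀ (by positivity), mul_comm]
  exact this

/-- The **Earle–Hamilton fixed point theorem** for balls: a holomorphic map sending a ball into
a strictly smaller concentric ball has a unique fixed point, and this fixed point is
nondegenerate. -/
theorem existsUnique_isFixedPt_of_mapsTo_closedBall [CompleteSpace E]
    (hf : DifferentiableOn ℂ f (ball 0 r)) (hmaps : MapsTo f (ball 0 r) (closedBall 0 s))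
    (hr : 0 < r) (hsr : s < r) :
    ∃ x ∈ ball 0 r, IsFixedPt f x ∧ (∀ y ∈ ball 0 r, IsFixedPt f y → y = x) ∧
      IsUnit (1 - fderiv ℂ f x) := by
  have hs : 0 ≤ s := nonempty_closedBall.1 ⟨_, hmaps (mem_ball_self hr)⟩
  have hsub : closedBall (0 : E) s ⊆ ball 0 r := closedBall_subset_ball hsr
  have hmaps' : MapsTo f (closedBall 0 s) (closedBall 0 s) := hmaps.mono_left hsub
  have hlim : Tendsto (fun n : ℕ => 2 * r / (r - s) * ((1 + (r - s) / (2 * r))⁻¹) ^ n) atTop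
      (𝓝 (2 * r / (r - s) * 0)) := by
    have : 0 < (r - s) / (2 * r) := div_pos (by linarith) (by linarith)
    exact (tendsto_pow_atTop_nhds_zero_of_lt_one (by positivity)
      (inv_lt_one_of_one_lt₀ (by linarith))).const_mul _
  rw [mul_zero] at hlim
  obtain ⟨n, hn⟩ := (hlim.eventually_lt_const (show (0 : ℝ) < 1 / 2 by norm_num)).exists
  have hLip : LipschitzOnWith (1 / 2) f^[n] (closedBall 0 s) := by
    choose! L hL hLn using fun (x : E) (hx : x ∈ closedBall 0 s) =>
      exists_hasFDerivAt_iterate_norm_le hf hmaps hsr hx n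
    refine Convex.lipschitzOnWith_of_nnnorm_hasFDerivWithin_le (𝕜 := ℂ)
      (fun x hx => (hL x hx).hasFDerivWithinAt) (fun x hx => ?_) (convex_closedBall _ _)
    rw [← NNReal.coe_le_coe]
    simpa using ((hLn x hx).trans hn.le)
  have : Nonempty (closedBall (0 : E) s) := ⟨⟨0, mem_closedBall_self hs⟩⟩
  have : CompleteSpace (closedBall (0 : E) s) := isClosed_closedBall.completeSpace_coe
  have hiter : (hmaps'.restrict)^[n] = (hmaps'.iterate n).restrict := hmaps'.iterate_restrict n
  have hcontr : ContractingWith (1 / 2) (hmaps'.restrict)^[n] := by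
    rw [hiter]
    exact ⟨by rw [← NNReal.coe_lt_coe]; norm_num, hLip.mapsToRestrict _⟩
  have hfix := hcontr.isFixedPt_fixedPoint_iterate
  set x := ContractingWith.fixedPoint _ hcontr with hx
  have hfx : IsFixedPt f x := congrArg Subtype.val hfix
  refine ⟨x, hsub x.2, hfx, fun y hy hfy => ?_, ?_⟩
  · have hys : y ∈ closedBall 0 s := hfy ▸ hmaps hy
    have hfy' : IsFixedPt hmaps'.restrict ⟨y, hys⟩ := Subtype.ext hfy
    exact congrArg Subtype.val (hcontr.fixedPoint_unique (hfy'.iterate n))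
  · obtain ⟨L, hL, hLn⟩ := exists_hasFDerivAt_iterate_norm_le hf hmaps hsr x.2 n
    have hfd : HasFDerivAt f (fderiv ℂ f x) x :=
      (hf.differentiableAt (isOpen_ball.mem_nhds (hsub x.2))).hasFDerivAt
    have hpow : fderiv ℂ f x ^ n = L := (hfd.iterate hfx n).unique hL
    have hunit : IsUnit (1 - fderiv ℂ f x ^ n) := by
      refine isUnit_one_sub_of_norm_lt_one ?_
      rw [hpow]
      linarith
    rw [← mul_neg_geom_sum] at hunit
    refine (Commute.isUnit_mul_iff ?_).1 hunit |>.1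
    exact (mul_neg_geom_sum _ _).trans (geom_sum_mul_neg _ _).symm

end EarleHamilton

/-- The **Schwarz–Pick lemma** at the centre of the disc, in a form free of denominators. -/
theorem Complex.norm_sub_mul_le_of_norm_le {f : ℂ → ℂ} {M : ℝ}
    (hf : DifferentiableOn ℂ f (ball 0 1)) (hM : ∀ z ∈ ball (0 : ℂ) 1, ‖f z‖ ≤ M)
    {z : ℂ} (hz : z ∈ ball (0 : ℂ) 1) :
    ‖f z - f 0‖ * M ≤ ‖z‖ * ‖(M : ℂ) ^ 2 - conj (f 0) * f z‖ := by
  have hM0 : 0 ≤ M := (norm_nonneg _).trans (hM z hz)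
  have key : ∀ m : ℝ, M < m → ‖f z - f 0‖ * m ≤ ‖z‖ * ‖(m : ℂ) ^ 2 - conj (f 0) * f z‖ := by
    intro m hm
    have hm0 : 0 < m := hM0.trans_lt hm
    have h0 : ‖f 0‖ ≤ M := hM 0 (by simp)
    have hne : ∀ w ∈ ball (0 : ℂ) 1, (m : ℂ) ^ 2 - conj (f 0) * f w ≠ 0 := by
      intro w hw h
      have h1 := congrArg norm (sub_eq_zero.1 h)
      rw [norm_pow, norm_mul, Complex.norm_conj, Complex.norm_real,
        Real.norm_of_nonneg hm0.le] at h1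
      nlinarith [hM w hw, norm_nonneg (f 0), norm_nonneg (f w)]
    have hbd : ∀ w ∈ ball (0 : ℂ) 1,
        ‖(f w - f 0) * m‖ ≤ ‖(m : ℂ) ^ 2 - conj (f 0) * f w‖ := by
      intro w hw
      refine le_of_sq_le_sq ?_ (norm_nonneg _)
      have ha : ‖f 0‖ ^ 2 ≤ m ^ 2 := by gcongr; linarith
      have hb : ‖f w‖ ^ 2 ≤ m ^ 2 := by gcongr; linarith [hM w hw]
      rw [Complex.sq_norm, Complex.normSq_apply] at ha hb
      rw [Complex.sq_norm, Complex.sq_norm, Complex.normSq_apply, Complex.normSq_apply]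
      simp only [pow_two, Complex.mul_re, Complex.mul_im, Complex.sub_re, Complex.sub_im,
        Complex.conj_re, Complex.conj_im, Complex.ofReal_re, Complex.ofReal_im]
      nlinarith [mul_nonneg (sub_nonneg.2 ha) (sub_nonneg.2 hb)]
    have := Complex.norm_le_norm_of_mapsTo_ball (R := 1)
      (f := fun w => (f w - f 0) * m / ((m : ℂ) ^ 2 - conj (f 0) * f w))
      (((hf.sub_const _).mul_const _).div ((hf.const_mul _).const_sub _) hne)
      (fun w hw => by
        rw [mem_closedBall_zero_iff, norm_div]
        exact div_le_one_of_le₀ (hbd w hw) (norm_nonneg _))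
      (by simp) (by simpa using hz)
    rwa [norm_div, div_le_iff₀ (norm_pos_iff.2 (hne z hz)), norm_mul, Complex.norm_real,
      Real.norm_of_nonneg hm0.le] at this
  refine le_of_tendsto_of_tendsto (b := 𝓝[>] M) ?_ ?_
    (eventually_mem_nhdsWithin.mono fun m hm => key m hm)
  · exact (Continuous.tendsto (by fun_prop : Continuous fun m : ℝ => ‖f z - f 0‖ * m) M).mono_left
      nhdsWithin_le_nhds
  · exact (Continuous.tendsto (by fun_prop : Continuous fun m : ℝ =>
      ‖z‖ * ‖(m : ℂ) ^ 2 - conj (f 0) * f z‖) M).mono_left nhdsWithin_le_nhds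

/-- The elementary optimisation behind the values of the Bloch radii. -/
theorem mul_le_of_schwarz_pick_of_le_bloch_radius {M S ρ a w : ℝ} (hM : 0 < M) (hS : 0 < S)
    (hS2 : S ^ 2 = 4 * M ^ 2 + 1) (hρ : ρ ≤ 1 / S) (ha : 0 ≤ a) (haM : a ≤ M)
    (hw : 0 ≤ w) (h : w * M ≤ ρ * (M ^ 2 - a ^ 2 + a * w)) :
    ρ * w ≤ 1 / S - 1 / (2 * M + S) := by
  have hS1 : 1 < S := by nlinarith
  have hSM : 2 * M < S := by nlinarith
  have h1 : w * M ≤ 1 / S * (M ^ 2 - a ^ 2 + a * w) :=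
    h.trans (by gcongr; nlinarith [mul_nonneg ha hw])
  rw [div_mul_eq_mul_div, one_mul, le_div_iff₀ hS] at h1
  have h2 : 0 < S * M - a := by nlinarith
  have h3 : w ≤ 2 * M * (S - 2 * M) := by
    refine le_of_mul_le_mul_right ?_ h2
    have : 2 * M * (S - 2 * M) * (S * M - a) - (M ^ 2 - a ^ 2) =
        (a - M * (S - 2 * M)) ^ 2 := by
      linear_combination (M ^ 2) * hS2
    nlinarith [sq_nonneg (a - M * (S - 2 * M))]
  have h4 : 1 / S - 1 / (2 * M + S) = 1 / S * (2 * M * (S - 2 * M)) := by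
    field_simp
    linear_combination (-2 * M) * hS2
  rw [h4]
  gcongr

section Bloch

variable {X : Type*} [NormedAddCommGroup X] [NormedSpace ℂ X] {h : X → X} {M : ℝ}

/-- On the ball whose radius is the first Bloch radius, a normalized bounded holomorphic map
differs from the identity by at most the difference of the two Bloch radii. -/
theorem norm_sub_self_le_sub_bloch_radii
    (hd : DifferentiableOn ℂ h (ball 0 1)) (h0 : h 0 = 0)
    (hD : fderiv ℂ h 0 = ContinuousLinearMap.id ℂ X)
    (hbound : ∀ x ∈ ball (0 : X) 1, ‖h x‖ ≤ M) {x : X}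
    (hx : x ∈ ball (0 : X) (1 / √(4 * M ^ 2 + 1))) :
    ‖h x - x‖ ≤ 1 / √(4 * M ^ 2 + 1) - 1 / (2 * M + √(4 * M ^ 2 + 1)) := by
  have hM0 : 0 ≤ M := (norm_nonneg _).trans (hbound 0 (by simp))
  have hS2 : √(4 * M ^ 2 + 1) ^ 2 = 4 * M ^ 2 + 1 := Real.sq_sqrt (by positivity)
  have hS : 0 < √(4 * M ^ 2 + 1) := Real.sqrt_pos.2 (by positivity)
  set S := √(4 * M ^ 2 + 1)
  rcases eq_or_ne (h x - x) 0 with heq | hne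
  · rw [heq, norm_zero, sub_nonneg]
    gcongr
    linarith
  have hx0 : x ≠ 0 := by
    rintro rfl
    simp [h0] at hne
  have hxn : 0 < ‖x‖ := norm_pos_iff.2 hx0
  have hx1 : ‖x‖ < 1 / S := by simpa using hx
  have hS1 : 1 ≤ S := by nlinarith
  have hx2 : ‖x‖ < 1 := hx1.trans_le (by rw [div_le_one hS]; exact hS1)
  have : Nontrivial X := ⟨x, 0, hx0⟩
  have hmaps : MapsTo h (ball 0 1) (closedBall (h 0) M) := fun y hy => by
    simpa [h0] using hbound y hy
  have hM1 : 1 ≤ M := by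
    have := Complex.norm_fderiv_le_div_of_mapsTo_ball hd hmaps one_pos
    rwa [hD, ContinuousLinearMap.norm_id, div_one] at this
  obtain ⟨ℓ, hℓ, hℓx⟩ := exists_dual_vector ℂ (h x - x) (norm_ne_zero_iff.2 hne)
  set e : X := ((‖x‖ : ℂ)⁻¹) • x with he
  have hen : ‖e‖ = 1 := by
    simp [he, norm_smul, hxn.ne']
  have hxe : (‖x‖ : ℂ) • e = x := by
    rw [he, smul_inv_smul₀]
    exact_mod_cast hxn.ne'
  set k : ℂ → ℂ := fun c => ℓ (h (c • e)) with hk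
  have hline : MapsTo (fun c : ℂ => c • e) (ball 0 1) (ball 0 1) := fun c hc => by
    simpa [norm_smul, hen] using hc
  have hkd : DifferentiableOn ℂ k (ball 0 1) :=
    ℓ.differentiable.comp_differentiableOn
      (hd.comp (differentiable_id.smul_const e).differentiableOn hline)
  have hk0 : k 0 = 0 := by simp [hk, h0]
  have hkmaps : MapsTo k (ball 0 1) (closedBall (k 0) M) := fun c hc => by
    rw [hk0, mem_closedBall_zero_iff]
    calc ‖ℓ (h (c • e))‖ ≤ ‖ℓ‖ * ‖h (c • e)‖ := ℓ.le_opNorm _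
      _ ≤ M := by rw [hℓ, one_mul]; exact hbound _ (hline hc)
  have hψd : DifferentiableOn ℂ (dslope k 0) (ball 0 1) :=
    (Complex.differentiableOn_dslope (ball_mem_nhds _ one_pos)).2 hkd
  have hψM : ∀ c ∈ ball (0 : ℂ) 1, ‖dslope k 0 c‖ ≤ M := fun c hc => by
    simpa using Complex.norm_dslope_le_div_of_mapsTo_ball hkd hkmaps hc
  have hψ0 : dslope k 0 0 = ℓ e := by
    rw [dslope_same]
    have h1 : HasFDerivAt h (ContinuousLinearMap.id ℂ X) ((0 : ℂ) • e) := by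
      rw [zero_smul, ← hD]
      exact (hd.differentiableAt (ball_mem_nhds _ one_pos)).hasFDerivAt
    have h2 : HasDerivAt (fun c : ℂ => c • e) e 0 := by
      simpa using (hasDerivAt_id (0 : ℂ)).smul_const e
    exact (ℓ.hasFDerivAt.comp_hasDerivAt (0 : ℂ) (h1.comp_hasDerivAt (0 : ℂ) h2)).deriv
  have hψx : (‖x‖ : ℂ) * (dslope k 0 ‖x‖ - dslope k 0 0) = ‖h x - x‖ := by
    have h1 := sub_smul_dslope k 0 (‖x‖ : ℂ)
    rw [sub_zero, hk0, sub_zero, smul_eq_mul] at h1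
    rw [mul_sub, h1, hψ0, ← smul_eq_mul, ← map_smul, hxe, hk]
    simp only [hxe]
    rw [← map_sub, hℓx]
    rfl
  have hmem : (‖x‖ : ℂ) ∈ ball (0 : ℂ) 1 := by simpa using hx2
  have hpick := Complex.norm_sub_mul_le_of_norm_le hψd hψM hmem
  set a := dslope k 0 0
  set b := dslope k 0 ‖x‖
  have hest : ‖(M : ℂ) ^ 2 - conj a * b‖ ≤ M ^ 2 - ‖a‖ ^ 2 + ‖a‖ * ‖b - a‖ := by
    have haM : ‖a‖ ^ 2 ≤ M ^ 2 := by
      have := hψM 0 (by simp)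
      gcongr
    have h1 : (M : ℂ) ^ 2 - conj a * b = ((M ^ 2 - ‖a‖ ^ 2 : ℝ) : ℂ) - conj a * (b - a) := by
      rw [mul_sub, Complex.conj_mul']
      push_cast
      ring
    rw [h1]
    refine (norm_sub_le _ _).trans_eq ?_
    rw [norm_mul, Complex.norm_conj, Complex.norm_real, Real.norm_of_nonneg (by linarith)]
  rw [Complex.norm_real, norm_norm] at hpick
  have := mul_le_of_schwarz_pick_of_le_bloch_radius (by linarith) hS hS2 hx1.le
    (norm_nonneg a) (hψM 0 (by simp)) (norm_nonneg (b - a))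
    (hpick.trans (mul_le_mul_of_nonneg_left hest hxn.le))
  have h2 := congrArg norm hψx
  rw [norm_mul, Complex.norm_real, Complex.norm_real, norm_norm, norm_norm] at h2
  rwa [← h2]

end Bloch

/-- A map which is analytic at `x` and has an invertible derivative there has an analytic local right
inverse taking `h x` to `x`. -/
theorem AnalyticAt.exists_analyticAt_rightInverse {X : Type*} [NormedAddCommGroup X]
    [NormedSpace ℂ X] [CompleteSpace X] {h : X → X} {x : X} (hx : AnalyticAt ℂ h x)
    (hunit : IsUnit (fderiv ℂ h x)) :
    ∃ g : X → X, AnalyticAt ℂ g (h x) ∧ g (h x) = x ∧ ∀ᶠ y in 𝓝 (h x), h (g y) = y := by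
  obtain ⟨u, hu⟩ := hunit
  let i : X ≃L[ℂ] X := ContinuousLinearEquiv.ofUnit u
  have hi : (i : X →L[ℂ] X) = fderiv ℂ h x := hu
  have hs : HasStrictFDerivAt h (i : X →L[ℂ] X) x := hi ▸ hx.hasStrictFDerivAt
  refine ⟨hs.localInverse h i x, ?_, hs.localInverse_apply_image, hs.eventually_right_inverse⟩
  exact (hs.toOpenPartialHomeomorph h).analyticAt_symm' hs.mem_toOpenPartialHomeomorph_source hx
    hi.symm

/-- **Bloch radii theorem of Harris.** Let `B` be the open unit ball of a complex Banach
space `X` and `h : B → X` holomorphic with `h 0 = 0`, `Dh(0) = Id`, and `‖h x‖ ≤ M` on `B`.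
Then, with `r = 1/√(4M²+1)` and `P = 1/(2M+√(4M²+1))`, there exists an open subset `U` of
the ball of radius `r` such that `h` maps `U` biholomorphically onto the ball of radius `P`:
`h` restricted to `U` is a bijection onto `B_P(0)` with holomorphic inverse. -/
theorem bloch_radii_harris {X : Type*}
    [NormedAddCommGroup X] [NormedSpace ℂ X] [CompleteSpace X]
    (h : X → X) (M : ℝ)
    (hol : AnalyticOnNhd ℂ h (Metric.ball (0 : X) 1))
    (h0 : h 0 = 0)
    (hD : fderiv ℂ h 0 = ContinuousLinearMap.id ℂ X)
    (hbound : ∀ x ∈ Metric.ball (0 : X) 1, ‖h x‖ ≤ M) :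
    ∃ U : Set X, IsOpen U ∧
      U ⊆ Metric.ball (0 : X) (1 / Real.sqrt (4 * M ^ 2 + 1)) ∧
      Set.BijOn h U (Metric.ball (0 : X) (1 / (2 * M + Real.sqrt (4 * M ^ 2 + 1)))) ∧
      ∃ g : X → X,
        AnalyticOnNhd ℂ g (Metric.ball (0 : X) (1 / (2 * M + Real.sqrt (4 * M ^ 2 + 1)))) ∧
        (∀ x ∈ U, g (h x) = x) ∧
        (∀ y ∈ Metric.ball (0 : X) (1 / (2 * M + Real.sqrt (4 * M ^ 2 + 1))), h (g y) = y) := by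
  have hd : DifferentiableOn ℂ h (ball 0 1) := hol.differentiableOn
  have hest := fun x hx => norm_sub_self_le_sub_bloch_radii hd h0 hD hbound (x := x) hx
  have hS2 : √(4 * M ^ 2 + 1) ^ 2 = 4 * M ^ 2 + 1 := Real.sq_sqrt (by positivity)
  have hS : 0 < √(4 * M ^ 2 + 1) := Real.sqrt_pos.2 (by positivity)
  have hr1 : 1 / √(4 * M ^ 2 + 1) ≤ 1 := by
    rw [div_le_one hS]
    nlinarith
  have hr : 0 < 1 / √(4 * M ^ 2 + 1) := by positivity
  set r := 1 / √(4 * M ^ 2 + 1)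
  set P := 1 / (2 * M + √(4 * M ^ 2 + 1))
  have hsub : ball (0 : X) r ⊆ ball 0 1 := ball_subset_ball hr1
  have hex : ∀ y ∈ ball (0 : X) P, ∃ x ∈ ball (0 : X) r, h x = y ∧
      (∀ z ∈ ball (0 : X) r, h z = y → z = x) ∧ IsUnit (fderiv ℂ h x) := by
    intro y hy
    rw [mem_ball_zero_iff] at hy
    have hfix : ∀ z, IsFixedPt (fun x => y + (x - h x)) z ↔ h z = y := fun z => by
      rw [IsFixedPt, add_sub_left_comm, add_eq_left, sub_eq_zero, eq_comm]
    obtain ⟨x, hx, hfx, huniq, hunit⟩ := existsUnique_isFixedPt_of_mapsTo_closedBall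
      (f := fun x => y + (x - h x)) (r := r) (s := ‖y‖ + (r - P))
      ((differentiableOn_id.sub (hd.mono hsub)).const_add _)
      (fun x hx => by
        rw [mem_closedBall_zero_iff]
        refine (norm_add_le _ _).trans ?_
        rw [norm_sub_rev]
        gcongr
        exact hest x hx) hr (by linarith)
    refine ⟨x, hx, (hfix x).1 hfx, fun z hz hzy => huniq z hz ((hfix z).2 hzy), ?_⟩
    have hder : HasFDerivAt (fun x => y + (x - h x))
        (ContinuousLinearMap.id ℂ X - fderiv ℂ h x) x :=
      ((hasFDerivAt_id x).sub (hol x (hsub hx)).differentiableAt.hasFDerivAt).const_add y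
    rw [hder.fderiv] at hunit
    convert! hunit using 1
    exact (sub_sub_cancel _ _).symm
  choose! g hgr hhg hguniq hgunit using hex
  refine ⟨ball 0 r ∩ h ⁻¹' ball 0 P, ?_, inter_subset_left, ⟨fun x hx => hx.2, ?_, ?_⟩, g, ?_,
    fun x hx => (hguniq _ hx.2 x hx.1 rfl).symm, hhg⟩
  · exact (hd.continuousOn.mono hsub).isOpen_inter_preimage isOpen_ball isOpen_ball
  · intro x hx z hz hxz
    rw [hguniq _ hx.2 x hx.1 rfl, hguniq _ hx.2 z hz.1 hxz.symm]
  · intro y hy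
    exact ⟨g y, ⟨hgr y hy, by simpa only [mem_preimage, hhg y hy] using hy⟩, hhg y hy⟩
  · intro y hy
    obtain ⟨k, hk, hky, hhk⟩ :=
      (hol (g y) (hsub (hgr y hy))).exists_analyticAt_rightInverse (hgunit y hy)
    rw [hhg y hy] at hk hky hhk
    refine hk.congr ?_
    have hkr : ∀ᶠ z in 𝓝 y, k z ∈ ball (0 : X) r :=
      hk.continuousAt.eventually_mem (by rw [hky]; exact isOpen_ball.mem_nhds (hgr y hy))
    filter_upwards [hkr, hhk, isOpen_ball.mem_nhds hy] with z hz1 hz2 hz3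
    exact hguniq z hz3 (k z) hz1 hz2
end

section
/- Let X and Y be complex Banach spaces, μ, ν > 0, K_m : X^m → Y bounded m-multilinear operators with ‖K_m(η₁,…,η_m)‖_Y ≤ ν μ^{m−1} ‖η₁‖_X ⋯ ‖η_m‖_X, and 𝒦₁ : Y → X a bounded linear operator. Let a, b ∈ X and suppose ℳ := max{‖a‖_X, ‖b‖_X} < 1/μ. Then the series Σ_{m=2}^∞ 𝒦₁[K_m(a,…,a) − K_m(b,…,b)] converges absolutely in X, and ‖a − b + Σ_{m=2}^∞ 𝒦₁[K_m(a,…,a) − K_m(b,…,b)]‖_X ≥ (1 − ν‖𝒦₁‖/(1 − μℳ)² + ν‖𝒦₁‖) ‖a − b‖_X. -/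
/-- The derivative of the geometric series without its constant term. -/
theorem hasSum_add_two_mul_geometric {r : ℝ} (h0 : 0 ≤ r) (h1 : r < 1) :
    HasSum (fun j : ℕ => ((j : ℝ) + 2) * r ^ (j + 1)) (1 / (1 - r) ^ 2 - 1) := by
  have h := hasSum_choose_mul_geometric_of_norm_lt_one 1
    (show ‖r‖ < 1 by rwa [Real.norm_of_nonneg h0])
  rw [← hasSum_nat_add_iff' 1] at h
  have hfun : (fun j : ℕ => ((j : ℝ) + 2) * r ^ (j + 1)) =
      fun n : ℕ => (((n + 1 + 1).choose 1 : ℕ) : ℝ) * r ^ (n + 1) := by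
    ext j
    push_cast [Nat.choose_one_right]
    ring
  rw [hfun]
  simpa using h

/-- Lipschitz bound for the diagonal of a bounded multilinear map followed by a bounded linear
map. -/
theorem norm_map_diag_sub_le {X Y : Type*}
    [NormedAddCommGroup X] [NormedSpace ℂ X] [NormedAddCommGroup Y] [NormedSpace ℂ Y]
    {μ ν : ℝ} (hμ : 0 < μ) (hν : 0 ≤ ν) {j : ℕ}
    (f : ContinuousMultilinearMap ℂ (fun _ : Fin (j + 2) => X) Y)
    (hf : ∀ η : Fin (j + 2) → X, ‖f η‖ ≤ ν * μ ^ (j + 2 - 1) * ∏ i, ‖η i‖)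
    (A : Y →L[ℂ] X) (a b : X) :
    ‖A (f (fun _ => a) - f (fun _ => b))‖ ≤
      ν * ‖A‖ * (((j : ℝ) + 2) * (μ * max ‖a‖ ‖b‖) ^ (j + 1)) * ‖a - b‖ := by
  have h := f.toMultilinearMap.norm_image_sub_le_of_bound
    (mul_nonneg hν (pow_nonneg hμ.le _)) hf (fun _ => a) (fun _ => b)
  have hsub : ((fun _ => a) - fun _ => b : Fin (j + 2) → X) = fun _ => a - b := rfl
  rw [hsub, pi_norm_const, pi_norm_const, pi_norm_const, Fintype.card_fin] at h
  calc
    _ ≤ ‖A‖ * ‖f (fun _ => a) - f (fun _ => b)‖ := A.le_opNorm _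
    _ ≤ ‖A‖ * _ := mul_le_mul_of_nonneg_left h (norm_nonneg _)
    _ = _ := by
      rw [mul_pow, show j + 2 - 1 = j + 1 from rfl]
      push_cast
      ring

/-- **Lower bound used in the error analysis.** For `a, b ∈ X` with
`ℳ = max{‖a‖,‖b‖} < 1/μ`, the series `∑_{m=2}^∞ 𝒦₁[K_m(a,…,a) − K_m(b,…,b)]`
converges absolutely, and
`‖a − b + ∑_{m=2}^∞ 𝒦₁[K_m(a,…,a) − K_m(b,…,b)]‖ ≥ (1 − ν‖𝒦₁‖/(1−μℳ)² + ν‖𝒦₁‖)‖a − b‖`.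
(The series `∑_{m=2}^∞` is written as `∑' j : ℕ` with `m = j + 2`.) -/
theorem lower_bound_difference {X Y : Type*}
    [NormedAddCommGroup X] [NormedSpace ℂ X] [CompleteSpace X]
    [NormedAddCommGroup Y] [NormedSpace ℂ Y] [CompleteSpace Y]
    (μ ν : ℝ) (hμ : 0 < μ) (hν : 0 < ν)
    (K : ∀ m : ℕ, ContinuousMultilinearMap ℂ (fun _ : Fin m => X) Y)
    (hK : ∀ m : ℕ, 1 ≤ m → ∀ η : Fin m → X,
      ‖K m η‖ ≤ ν * μ ^ (m - 1) * ∏ i, ‖η i‖)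
    (A : Y →L[ℂ] X)
    (a b : X)
    (ℳ : ℝ) (hℳdef : ℳ = max ‖a‖ ‖b‖) (hℳ : ℳ < 1 / μ) :
    (Summable fun j : ℕ =>
      ‖A (K (j + 2) (fun _ => a) - K (j + 2) (fun _ => b))‖) ∧
    (1 - ν * ‖A‖ / (1 - μ * ℳ) ^ 2 + ν * ‖A‖) * ‖a - b‖ ≤
      ‖a - b + ∑' j : ℕ, A (K (j + 2) (fun _ => a) - K (j + 2) (fun _ => b))‖ := by
  have hM0 : 0 ≤ ℳ := hℳdef ▸ (norm_nonneg a).trans (le_max_left _ _)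
  have hr1 : μ * ℳ < 1 := by
    rw [lt_div_iff₀ hμ] at hℳ
    linarith
  have hbound := fun j : ℕ => norm_map_diag_sub_le hμ hν.le (K (j + 2))
    (hK (j + 2) (by omega)) A a b
  rw [← hℳdef] at hbound
  have hsum := ((hasSum_add_two_mul_geometric (mul_nonneg hμ.le hM0) hr1).mul_left
    (ν * ‖A‖)).mul_right ‖a - b‖
  refine ⟨hsum.summable.of_nonneg_of_le (fun _ => norm_nonneg _) hbound, ?_⟩
  have htsum := tsum_of_norm_bounded hsum hbound
  have htri := norm_sub_le_norm_add (a - b)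
    (∑' j : ℕ, A (K (j + 2) (fun _ => a) - K (j + 2) (fun _ => b)))
  calc
    _ = ‖a - b‖ - ν * ‖A‖ * (1 / (1 - μ * ℳ) ^ 2 - 1) * ‖a - b‖ := by ring
    _ ≤ _ := by linarith
end
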